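/- arXiv:1609.03184 — 2 statements merged into one kernel-verified Lean document; each statement's English description precedes it below -/
import Mathlib

section
/- Let K divide into angles θ_k = 2πk/K for k = 1,...,K, and define N×N complex matrices R_k by [R_k]_{m,n} = ρ^{|m−n|} e^{i(m−n)θ_k} for 0 ≤ ρ < 1 and N ≤ K. Then (1/K) ∑_{k=1}^{K} R_k = I_N. -/
/-- The powers `w, w², …, w ^ K` of a `K`-th root of unity `w ≠ 1` sum to zero. -/
theorem sum_Icc_pow_eq_zero_of_pow_eq_one {F : Type*} [Field F] {w : F} {K : ℕ}
    (hw : w ^ K = 1) (hw1 : w ≠ 1) : ∑ k ∈ Finset.Icc 1 K, w ^ k = 0 := by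
  rw [← Finset.Ico_add_one_right_eq_Icc, geom_sum_Ico hw1 (by omega), pow_succ, hw]
  simp

theorem stmt_5 (N K : ℕ) (hK : 0 < K) (hN : N ≤ K) (ρ : ℝ) (hρ0 : 0 ≤ ρ) (hρ1 : ρ < 1)
    (θ : ℕ → ℝ) (hθ : ∀ k, θ k = 2 * Real.pi * k / K)
    (R : ℕ → Matrix (Fin N) (Fin N) ℂ)
    (hR : ∀ k m n, R k m n = (ρ : ℂ) ^ ((m : ℤ) - (n : ℤ)).natAbs *
      Complex.exp (Complex.I * ((m : ℤ) - (n : ℤ)) * θ k)) :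
    (1 / (K : ℂ)) • ∑ k ∈ Finset.Icc 1 K, R k = 1 := by
  have hK0 : (K : ℂ) ≠ 0 := Nat.cast_ne_zero.mpr hK.ne'
  have hζ := Complex.isPrimitiveRoot_exp K hK.ne'
  set ζ := Complex.exp (2 * Real.pi * Complex.I / K) with hζ_def
  ext m n
  have hterm (k : ℕ) : R k m n = (ρ : ℂ) ^ ((m : ℤ) - (n : ℤ)).natAbs *
      (ζ ^ ((m : ℤ) - (n : ℤ))) ^ k := by
    rw [hR, hθ, hζ_def, ← Complex.exp_int_mul, ← Complex.exp_nat_mul]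
    congr 2
    push_cast
    ring
  simp only [Matrix.smul_apply, Matrix.sum_apply, hterm, ← Finset.mul_sum, smul_eq_mul]
  rcases eq_or_ne m n with rfl | hmn
  · simp [hK0]
  · rw [sum_Icc_pow_eq_zero_of_pow_eq_one, Matrix.one_apply_ne hmn]
    · simp
    · rw [← zpow_natCast, zpow_comm, zpow_natCast, hζ.pow_eq_one, one_zpow]
    · rw [Ne, hζ.zpow_eq_one_iff_dvd]
      intro hdvd
      have hm := m.isLt
      have hn := n.isLt
      have := Int.eq_zero_of_abs_lt_dvd hdvd (by rw [abs_lt]; omega)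
      exact hmn (Fin.ext (by omega))
end

section
/- Let H be an N×K complex matrix with columns h_1,...,h_K, β > 0, and W = H H* + β I_N. Then for each k, h_k* W^{-1} h_k / (1 − h_k* W^{-1} h_k) = h_k* (∑_{i≠k} h_i h_i* + β I_N)^{-1} h_k, and in particular 0 ≤ h_k* W^{-1} h_k < 1. -/
open Matrix

/-- The bilinear-form version of the Sherman–Morrison formula. -/
theorem Matrix.dotProduct_inv_add_vecMulVec_mulVec_mul {n R : Type*} [Fintype n] [DecidableEq n]
    [CommRing R] {A : Matrix n n R} {u v : n → R} (hA : IsUnit A)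
    (hW : IsUnit (A + vecMulVec u v)) :
    (v ⬝ᵥ ((A + vecMulVec u v)⁻¹ *ᵥ u)) * (1 + v ⬝ᵥ (A⁻¹ *ᵥ u)) = v ⬝ᵥ (A⁻¹ *ᵥ u) := by
  have hAu : (A + vecMulVec u v) *ᵥ (A⁻¹ *ᵥ u) = (1 + v ⬝ᵥ (A⁻¹ *ᵥ u)) • u := by
    rw [add_mulVec, vecMulVec_mulVec, mulVec_mulVec,
      mul_nonsing_inv _ ((isUnit_iff_isUnit_det _).1 hA), one_mulVec, op_smul_eq_smul,
      add_smul, one_smul]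
  have hdot := congrArg (fun x => v ⬝ᵥ ((A + vecMulVec u v)⁻¹ *ᵥ x)) hAu
  beta_reduce at hdot
  rw [mulVec_mulVec (A⁻¹ *ᵥ u), nonsing_inv_mul _ ((isUnit_iff_isUnit_det _).1 hW), one_mulVec,
    mulVec_smul, dotProduct_smul, smul_eq_mul, mul_comm] at hdot
  exact hdot.symm

/-- The Gram matrix `H * Hᴴ` is the sum of the outer products of the columns of `H`. -/
theorem Matrix.mul_conjTranspose_eq_sum_vecMulVec {m n R : Type*} [Fintype n]
    [NonUnitalNonAssocSemiring R] [StarRing R] (H : Matrix m n R) :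
    H * Hᴴ = ∑ i, vecMulVec (H.col i) (star (H.col i)) := by
  ext a b
  simp [mul_apply, sum_apply, vecMulVec_apply]

theorem stmt_6 (N K : ℕ) (H : Matrix (Fin N) (Fin K) ℂ) (β : ℝ) (hβ : 0 < β)
    (h : Fin K → (Fin N → ℂ)) (hcol : ∀ i j, h i j = H j i)
    (W : Matrix (Fin N) (Fin N) ℂ) (hW : W = H * H.conjTranspose + (β : ℂ) • 1)
    (k : Fin K) (q : ℂ) (hq : q = star (h k) ⬝ᵥ (W⁻¹ *ᵥ h k)) :
    q / (1 - q) =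
      star (h k) ⬝ᵥ
        (((∑ i ∈ Finset.univ.erase k, Matrix.vecMulVec (h i) (star (h i))) +
            (β : ℂ) • 1)⁻¹ *ᵥ h k) ∧
    q.im = 0 ∧ 0 ≤ q.re ∧ q.re < 1 := by
  open scoped ComplexOrder in
  obtain rfl : h = H.col := by
    ext i j
    exact hcol i j
  set A := (∑ i ∈ Finset.univ.erase k, vecMulVec (H.col i) (star (H.col i))) + (β : ℂ) • 1
    with hA_def
  have hA : A.PosDef :=
    (PosDef.one.smul (by exact_mod_cast hβ)).posSemidef_add
      (posSemidef_sum _ fun i _ => posSemidef_vecMulVec_self_star _)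
  have hWA : W = A + vecMulVec (H.col k) (star (H.col k)) := by
    rw [hW, mul_conjTranspose_eq_sum_vecMulVec, ← Finset.sum_erase_add _ _ (Finset.mem_univ k),
      hA_def]
    abel
  have hW_unit : IsUnit (A + vecMulVec (H.col k) (star (H.col k))) :=
    (hA.add_posSemidef (posSemidef_vecMulVec_self_star _)).isUnit
  have hqp := dotProduct_inv_add_vecMulVec_mulVec_mul hA.isUnit hW_unit
  rw [← hWA, ← hq] at hqp
  have hp := hA.inv.posSemidef.dotProduct_mulVec_nonneg (H.col k)
  generalize star (H.col k) ⬝ᵥ (A⁻¹ *ᵥ H.col k) = p at hqp hp ⊢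
  obtain ⟨r, hr, rfl⟩ : ∃ r : ℝ, 0 ≤ r ∧ (r : ℂ) = p :=
    ⟨p.re, (Complex.nonneg_iff.1 hp).1, (Complex.eq_re_of_ofReal_le hp).symm⟩
  have hr1 : (1 + r : ℂ) ≠ 0 := by exact_mod_cast (by positivity : 1 + r ≠ 0)
  obtain rfl : q = ((r / (1 + r) : ℝ) : ℂ) := by
    push_cast
    exact eq_div_of_mul_eq hr1 hqp
  refine ⟨?_, Complex.ofReal_im _, ?_, ?_⟩
  · push_cast
    rw [one_sub_div hr1, add_sub_cancel_right, div_div_div_cancel_right₀ hr1, div_one]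
  · rw [Complex.ofReal_re]
    positivity
  · rw [Complex.ofReal_re, div_lt_one (by positivity)]
    linarith
end
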